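/- For every k ≥ 2 and every n with 2^{k-1} + 1 ≤ n ≤ 2^{k-1} + 2^{⌊k/2⌋}, there exists a simple series-parallel broadcast graph on n vertices; that is, a simple SP graph G on n vertices with b(G) = ⌈log₂ n⌉ = k. -/

import Mathlib

/-- A broadcast scheme from originator `v`: `A i` is the set of informed vertices
after `i` time units.  At time 0 only `v` is informed, and during each time unit every
informed vertex may inform at most one uninformed neighbor. -/
def IsBroadcastScheme {V : Type*} [DecidableEq V] (G : SimpleGraph V) (v : V)
    (A : ℕ → Finset V) : Prop :=
  A 0 = {v} ∧
  ∀ i : ℕ, A i ⊆ A (i + 1) ∧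
    ∃ f : V → V,
      (∀ w ∈ A (i + 1) \ A i, f w ∈ A i ∧ G.Adj (f w) w) ∧
      Set.InjOn f ↑(A (i + 1) \ A i)

/-- `b(v, G)`: the minimum number of time units needed to inform all vertices from `v`. -/
noncomputable def broadcastTimeFrom {V : Type*} [DecidableEq V] [Fintype V]
    (G : SimpleGraph V) (v : V) : ℕ :=
  sInf {T | ∃ A : ℕ → Finset V, IsBroadcastScheme G v A ∧ A T = Finset.univ}

/-- `b(G)`: the maximum over all originators `v` of `b(v, G)`. -/
noncomputable def broadcastTime {V : Type*} [DecidableEq V] [Fintype V]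
    (G : SimpleGraph V) : ℕ :=
  Finset.univ.sup fun v => broadcastTimeFrom G v

/-- Multigraphs (a finite vertex set `V ⊆ ℕ` together with a multiset of edges) obtainable
from the base multigraph `(V₀, E₀)` by a finite sequence of parallel extensions (adding a
new edge parallel to an existing edge) and series extensions (replacing an edge `{u, w}`
by a path `u – x – w` through a new vertex `x`). -/
inductive SPBuildFrom (V₀ : Finset ℕ) (E₀ : Multiset (Sym2 ℕ)) :
    Finset ℕ → Multiset (Sym2 ℕ) → Prop
  | base : SPBuildFrom V₀ E₀ V₀ E₀
  | parallel {V : Finset ℕ} {E : Multiset (Sym2 ℕ)} (e : Sym2 ℕ) (he : e ∈ E) :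
      SPBuildFrom V₀ E₀ V E → SPBuildFrom V₀ E₀ V (e ::ₘ E)
  | series {V : Finset ℕ} {E : Multiset (Sym2 ℕ)} (u w x : ℕ)
      (he : s(u, w) ∈ E) (hx : x ∉ V) :
      SPBuildFrom V₀ E₀ V E →
      SPBuildFrom V₀ E₀ (insert x V) (s(u, x) ::ₘ s(x, w) ::ₘ E.erase s(u, w))

/-- The simple graph underlying the multigraph `(V, E)`. -/
def underlyingGraph (V : Finset ℕ) (E : Multiset (Sym2 ℕ)) : SimpleGraph {x // x ∈ V} :=
  SimpleGraph.fromRel fun a b => s((a : ℕ), (b : ℕ)) ∈ E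

/-- A simple graph is series-parallel if it is isomorphic to the underlying simple graph of
a multigraph obtained from a single edge on two terminals by series and parallel
extensions. -/
def IsSP {α : Type*} (G : SimpleGraph α) : Prop :=
  ∃ (sv tv : ℕ) (V : Finset ℕ) (E : Multiset (Sym2 ℕ)), sv ≠ tv ∧
    SPBuildFrom {sv, tv} {s(sv, tv)} V E ∧ Nonempty (G ≃g underlyingGraph V E)

/-- `Covers G t a S`: starting from `a`, all of `S` can be informed within `t` time units using
calls inside `S`. -/
inductive Covers {V : Type*} [DecidableEq V] (G : SimpleGraph V) : ℕ → V → Finset V → Prop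
  | single (t : ℕ) (a : V) : Covers G t a {a}
  | call {t : ℕ} {a b : V} {S S' : Finset V} (hab : G.Adj a b) (hd : Disjoint S S')
      (ha : Covers G t a S) (hb : Covers G t b S') : Covers G (t + 1) a (S ∪ S')

/-- `BinomialSubtree G a c C`: the graph `G` contains, on the vertex set `C`, a subtree of the
binomial tree of order `a` rooted at `c`. -/
inductive BinomialSubtree {V : Type*} [DecidableEq V] (G : SimpleGraph V) :
    ℕ → V → Finset V → Prop
  | single (c : V) : BinomialSubtree G 0 c {c}
  | skip {a : ℕ} {c : V} {C : Finset V} (h : BinomialSubtree G a c C) :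
      BinomialSubtree G (a + 1) c C
  | join {a : ℕ} {l r : V} {L R : Finset V} (hlr : G.Adj l r) (hd : Disjoint L R)
      (hl : BinomialSubtree G a l L) (hr : BinomialSubtree G a r R) :
      BinomialSubtree G (a + 1) l (L ∪ R)

section Broadcast

variable {V : Type*} [DecidableEq V] {G : SimpleGraph V}

theorem Covers.succ {t : ℕ} {a : V} {S : Finset V} (h : Covers G t a S) :
    Covers G (t + 1) a S := by
  induction h with
  | single t a => exact .single _ a
  | call hab hd _ _ iha ihb => exact .call hab hd iha ihb

theorem Covers.mono {t u : ℕ} {a : V} {S : Finset V} (h : Covers G t a S) (htu : t ≤ u) :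
    Covers G u a S := by
  induction htu with
  | refl => exact h
  | step _ ih => exact ih.succ

theorem Covers.exists_scheme {t : ℕ} {a : V} {S : Finset V} (h : Covers G t a S) :
    ∃ A : ℕ → Finset V, IsBroadcastScheme G a A ∧ A t = S ∧ ∀ i, A i ⊆ S := by
  induction h with
  | single t a => exact ⟨fun _ => {a}, ⟨rfl, fun i => ⟨subset_rfl, id, by simp, by simp⟩⟩, rfl,
      fun _ => subset_rfl⟩
  | @call t a b S S' hab hd _ _ iha ihb =>
    obtain ⟨A, ⟨hA0, hA⟩, hAt, hAS⟩ := iha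
    obtain ⟨B, ⟨hB0, hB⟩, hBt, hBS⟩ := ihb
    refine ⟨fun i => Nat.casesOn i {a} fun j => A j ∪ B j, ⟨rfl, ?_⟩, ?_, ?_⟩
    · rintro (_ | i)
      · have hmem : ∀ w ∈ (A 0 ∪ B 0) \ {a}, w = b := fun w hw => by
          simp only [hA0, hB0, Finset.mem_sdiff, Finset.mem_union, Finset.mem_singleton] at hw
          exact hw.1.resolve_left hw.2
        refine ⟨by simp [hA0], fun _ => a, ?_, ?_⟩
        · intro w hw
          obtain rfl := hmem w hw
          exact ⟨Finset.mem_singleton_self a, hab⟩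
        · exact fun x hx y hy _ => (hmem x hx).trans (hmem y hy).symm
      · obtain ⟨hAi, f, hf, hfi⟩ := hA i
        obtain ⟨hBi, g, hg, hgi⟩ := hB i
        refine ⟨Finset.union_subset_union hAi hBi,
          fun w => if w ∈ A (i + 1) then f w else g w, ?_, ?_⟩
        · intro w hw
          simp only [Finset.mem_sdiff, Finset.mem_union, not_or] at hw hf hg ⊢
          obtain ⟨hw1, hw2, hw3⟩ := hw
          by_cases hwA : w ∈ A (i + 1)
          · rw [if_pos hwA]
            exact ⟨.inl (hf w ⟨hwA, hw2⟩).1, (hf w ⟨hwA, hw2⟩).2⟩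
          · rw [if_neg hwA]
            have hwB := hw1.resolve_left hwA
            exact ⟨.inr (hg w ⟨hwB, hw3⟩).1, (hg w ⟨hwB, hw3⟩).2⟩
        · intro x hx y hy hxy
          simp only [Finset.coe_sdiff, Finset.coe_union, Set.mem_sdiff, Set.mem_union,
            Finset.mem_coe, not_or] at hx hy
          simp only [Finset.mem_sdiff] at hf hg
          have hne : ∀ u ∈ A i, ∀ w ∈ B i, u ≠ w := fun u hu w hw =>
            Finset.disjoint_iff_ne.1 hd u (hAS i hu) w (hBS i hw)
          by_cases hxA : x ∈ A (i + 1) <;> by_cases hyA : y ∈ A (i + 1) <;>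
            simp only [hxA, hyA, if_true, if_false] at hxy
          · exact hfi (by simpa using ⟨hxA, hx.2.1⟩) (by simpa using ⟨hyA, hy.2.1⟩) hxy
          · exact absurd hxy (hne _ (hf x ⟨hxA, hx.2.1⟩).1 _
              (hg y ⟨hy.1.resolve_left hyA, hy.2.2⟩).1)
          · exact absurd hxy.symm (hne _ (hf y ⟨hyA, hy.2.1⟩).1 _
              (hg x ⟨hx.1.resolve_left hxA, hx.2.2⟩).1)
          · exact hgi (by simpa using ⟨hx.1.resolve_left hxA, hx.2.2⟩)
              (by simpa using ⟨hy.1.resolve_left hyA, hy.2.2⟩) hxy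
    · simp [hAt, hBt]
    · rintro (_ | i)
      · have ha := hAS 0
        rw [hA0] at ha
        exact ha.trans Finset.subset_union_left
      · exact Finset.union_subset_union (hAS i) (hBS i)

theorem IsBroadcastScheme.card_le {v : V} {A : ℕ → Finset V} (hA : IsBroadcastScheme G v A)
    (i : ℕ) : (A i).card ≤ 2 ^ i := by
  induction i with
  | zero => simp [hA.1]
  | succ i ih =>
    obtain ⟨hsub, f, hf, hinj⟩ := hA.2 i
    have h1 : (A (i + 1) \ A i).card ≤ (A i).card :=
      Finset.card_le_card_of_injOn f (fun w hw => (hf w hw).1) hinj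
    have h2 := Finset.card_sdiff_add_card_eq_card hsub
    rw [pow_succ]
    lia

theorem broadcastTime_eq_clog [Fintype V] [Nonempty V]
    (h : ∀ v, Covers G (Nat.clog 2 (Fintype.card V)) v Finset.univ) :
    broadcastTime G = Nat.clog 2 (Fintype.card V) := by
  have hmem : ∀ v, Nat.clog 2 (Fintype.card V) ∈
      {T | ∃ A : ℕ → Finset V, IsBroadcastScheme G v A ∧ A T = Finset.univ} := fun v => by
    obtain ⟨A, hA, hAt, -⟩ := (h v).exists_scheme
    exact ⟨A, hA, hAt⟩
  apply le_antisymm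
  · exact Finset.sup_le fun v _ => Nat.sInf_le (hmem v)
  · obtain ⟨v⟩ := ‹Nonempty V›
    refine le_trans ?_ (Finset.le_sup (f := fun v => broadcastTimeFrom G v) (Finset.mem_univ v))
    obtain ⟨A, hA, hAt⟩ := Nat.sInf_mem ⟨_, hmem v⟩
    have hcard := hA.card_le (broadcastTimeFrom G v)
    unfold broadcastTimeFrom at hcard
    rw [hAt, Finset.card_univ] at hcard
    exact (Nat.clog_le_iff_le_pow (by norm_num)).2 hcard

namespace BinomialSubtree

theorem covers {a : ℕ} {c : V} {C : Finset V} (h : BinomialSubtree G a c C) :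
    Covers G a c C := by
  induction h with
  | single c => exact .single 0 c
  | skip _ ih => exact ih.succ
  | join hlr hd _ _ ihl ihr => exact .call hlr hd ihl ihr

/-- If the root can take care of a set `W` outside the tree on top of any work of `a` time units,
finishing at time `t + 1`, then every vertex of the tree can reach the tree and `W` by time
`t + a + 1`. -/
theorem covers_union {a : ℕ} {c : V} {C : Finset V} (h : BinomialSubtree G a c C) :
    ∀ (t : ℕ) (W : Finset V), a ≤ t + 1 → Disjoint C W →
      (∀ S ⊆ C, Covers G a c S → Covers G (t + 1) c (S ∪ W)) →
      ∀ v ∈ C, Covers G (t + a + 1) v (C ∪ W) := by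
  induction h with
  | single c =>
    intro t W _ _ hW v hv
    rw [Finset.mem_singleton.1 hv]
    exact hW _ subset_rfl (.single 0 c)
  | skip _ ih =>
    intro t W hat hd hW v hv
    exact (ih t W (by lia) hd (fun S hS h => hW S hS h.succ) v hv).mono (by lia)
  | @join a l r L R hlr hd hl hr ihl ihr =>
    intro t W hat hdW hW v hv
    rw [Finset.disjoint_union_left] at hdW
    rcases Finset.mem_union.1 hv with hv | hv
    · have := ihl t (R ∪ W) (by lia) (Finset.disjoint_union_right.2 ⟨hd, hdW.1⟩)
        (fun S hS h => by
          rw [← Finset.union_assoc]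
          exact hW _ (Finset.union_subset_union hS subset_rfl)
            (.call hlr (hd.mono_left hS) h hr.covers)) v hv
      rw [Finset.union_assoc]
      exact this.mono (by lia)
    · have := ihr (t + 1) (L ∪ W) (by lia) (Finset.disjoint_union_right.2 ⟨hd.symm, hdW.2⟩)
        (fun S hS h => .call hlr.symm
          (Finset.disjoint_union_right.2 ⟨hd.symm.mono_left hS, hdW.2.mono_left hS⟩)
          (h.mono (by lia)) (hW L Finset.subset_union_left hl.covers.succ)) v hv
      rw [Finset.union_comm L R, Finset.union_assoc]
      exact this.mono (by lia)

theorem covers_of_mem {a : ℕ} {c v : V} {C : Finset V} (h : BinomialSubtree G a c C)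
    (hv : v ∈ C) : Covers G (2 * a - 1) v C := by
  induction h with
  | single c => rw [Finset.mem_singleton.1 hv]; exact .single _ c
  | skip _ ih => exact (ih hv).mono (by lia)
  | @join a l r L R hlr hd hl hr _ _ =>
    rcases Finset.mem_union.1 hv with hv | hv
    · exact (hl.covers_union a R (by lia) hd
        (fun S hS h => .call hlr (hd.mono_left hS) h hr.covers) v hv).mono (by lia)
    · rw [Finset.union_comm]
      exact (hr.covers_union a L (by lia) hd.symm
        (fun S hS h => .call hlr.symm (hd.symm.mono_left hS) h hl.covers) v hv).mono (by lia)

theorem root_mem {a : ℕ} {c : V} {C : Finset V} (h : BinomialSubtree G a c C) : c ∈ C := by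
  induction h with
  | single c => simp
  | skip _ ih => exact ih
  | join _ _ _ _ ihl _ => exact Finset.mem_union_left _ ihl

/-- Each vertex `v` lies in a subtree `D` of order `i` whose complement splits into subtrees of
orders `i, …, a - 1`, so that a vertex adjacent to the whole tree can inform it in addition to
any work of `i` time units. -/
theorem exists_sdiff_covers {i a : ℕ} {h c v : V} {C : Finset V} (hC : BinomialSubtree G a c C)
    (hi : i ≤ a) (hadj : ∀ w ∈ C, G.Adj h w) (hv : v ∈ C) :
    ∃ d D, v ∈ D ∧ D ⊆ C ∧ BinomialSubtree G i d D ∧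
      ∀ S, Disjoint S C → Covers G i h S → Covers G a h (S ∪ (C \ D)) := by
  induction hC with
  | single c =>
    obtain rfl := Nat.le_zero.1 hi
    exact ⟨c, {c}, hv, subset_rfl, .single c, fun S _ hS => by simpa using hS⟩
  | @skip a c C hC ih =>
    rcases hi.eq_or_lt with rfl | hi
    · exact ⟨c, C, hv, subset_rfl, hC.skip, fun S _ hS => by simpa using hS⟩
    obtain ⟨d, D, hvD, hDC, hD, hcov⟩ := ih (Nat.le_of_lt_succ hi) hadj hv
    exact ⟨d, D, hvD, hDC, hD, fun S hd hS => (hcov S hd hS).succ⟩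
  | @join a l r L R hlr hd hl hr ihl ihr =>
    rcases hi.eq_or_lt with rfl | hi
    · exact ⟨l, L ∪ R, hv, subset_rfl, .join hlr hd hl hr, fun S _ hS => by simpa using hS⟩
    have key : ∀ {y : V} {X Y : Finset V}, BinomialSubtree G a y Y → Disjoint X Y →
        (∀ w ∈ X ∪ Y, G.Adj h w) →
        (∃ d D, v ∈ D ∧ D ⊆ X ∧ BinomialSubtree G i d D ∧
          ∀ S, Disjoint S X → Covers G i h S → Covers G a h (S ∪ (X \ D))) →
        ∃ d D, v ∈ D ∧ D ⊆ X ∪ Y ∧ BinomialSubtree G i d D ∧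
          ∀ S, Disjoint S (X ∪ Y) → Covers G i h S →
            Covers G (a + 1) h (S ∪ ((X ∪ Y) \ D)) := by
      rintro y X Y hY hXY hadj ⟨d, D, hvD, hDX, hD, hcov⟩
      refine ⟨d, D, hvD, hDX.trans Finset.subset_union_left, hD, fun S hS hcS => ?_⟩
      rw [Finset.disjoint_union_right] at hS
      rw [Finset.union_sdiff_distrib, Finset.sdiff_eq_self_of_disjoint (hXY.symm.mono_right hDX),
        ← Finset.union_assoc]
      exact .call (hadj y (Finset.mem_union_right _ hY.root_mem))
        (Finset.disjoint_union_left.2 ⟨hS.2, hXY.mono_left Finset.sdiff_subset⟩)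
        (hcov S hS.1 hcS) hY.covers
    have hadjL : ∀ w ∈ L, G.Adj h w := fun w hw => hadj w (Finset.mem_union_left _ hw)
    have hadjR : ∀ w ∈ R, G.Adj h w := fun w hw => hadj w (Finset.mem_union_right _ hw)
    rcases Finset.mem_union.1 hv with hv | hv
    · exact key hr hd hadj (ihl (Nat.le_of_lt_succ hi) hadjL hv)
    · rw [Finset.union_comm] at hadj ⊢
      exact key hl hd.symm hadj (ihr (Nat.le_of_lt_succ hi) hadjR hv)

theorem covers_insert_erase {a : ℕ} {h c v : V} {C : Finset V} (hC : BinomialSubtree G a c C)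
    (hadj : ∀ w ∈ C, G.Adj h w) (hv : v ∈ C) : Covers G a h (insert h (C.erase v)) := by
  obtain ⟨d, D, hvD, -, hD, hcov⟩ := hC.exists_sdiff_covers (Nat.zero_le a) hadj hv
  cases hD
  obtain rfl := Finset.mem_singleton.1 hvD
  have := hcov {h} (Finset.disjoint_singleton_left.2 fun hh => G.irrefl (hadj h hh)) (.single 0 h)
  rwa [Finset.sdiff_singleton_eq_erase, ← Finset.insert_eq] at this

/-- Labelling rule for binomial trees: the interval of length `2 ^ a` starting at a multiple `b`
of `2 ^ a`, cut off at `N`, is a subtree of the binomial tree of order `a`. -/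
theorem of_labelling {N : ℕ} {e : ℕ → V} (he : Set.InjOn e (Set.Iio N))
    (hadj : ∀ a b, 2 ^ (a + 1) ∣ b → b + 2 ^ a < N → G.Adj (e b) (e (b + 2 ^ a))) :
    ∀ a b, 2 ^ a ∣ b → b < N →
      BinomialSubtree G a (e b) ((Finset.Ico b (min (b + 2 ^ a) N)).image e) := by
  intro a
  induction a with
  | zero =>
    intro b _ hb
    have : Finset.Ico b (min (b + 2 ^ 0) N) = {b} := by ext x; simp; lia
    rw [this, Finset.image_singleton]
    exact .single _
  | succ a ih =>
    intro b hdvd hb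
    have hpos : 0 < 2 ^ a := by positivity
    have hp : 2 ^ (a + 1) = 2 ^ a + 2 ^ a := by ring
    have hdvd' : 2 ^ a ∣ b := (pow_dvd_pow 2 a.le_succ).trans hdvd
    by_cases hlt : b + 2 ^ a < N
    · have hsplit : Finset.Ico b (min (b + 2 ^ (a + 1)) N) =
          Finset.Ico b (min (b + 2 ^ a) N) ∪
            Finset.Ico (b + 2 ^ a) (min (b + 2 ^ a + 2 ^ a) N) := by
        ext x; simp; lia
      rw [hsplit, Finset.image_union]
      refine .join (hadj a b hdvd hlt) ?_ (ih b hdvd' hb)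
        (ih _ (dvd_add hdvd' dvd_rfl) hlt)
      rw [Finset.disjoint_left]
      simp only [Finset.mem_image, Finset.mem_Ico, not_exists, not_and]
      rintro _ ⟨x, hx, rfl⟩ y hy hyx
      have := he (by simp; lia) (by simp; lia) hyx
      lia
    · have heq : min (b + 2 ^ (a + 1)) N = min (b + 2 ^ a) N := by lia
      rw [heq]
      exact .skip (ih b hdvd' hb)

end BinomialSubtree

/-- A vertex `h` joined to a binomial tree of order `k - 1` and to a subtree of the binomial tree
of order `⌊k / 2⌋` sharing one vertex with it: broadcasting takes at most `k` time units. -/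
theorem covers_univ_of_apex [Fintype V] {k : ℕ} (hk : 2 ≤ k) {h y c d : V} {C F : Finset V}
    (hC : BinomialSubtree G (k - 1) c C) (hF : BinomialSubtree G (k / 2) d F)
    (hCF : C ∩ F = {y}) (hadj : ∀ w ∈ C ∪ F, G.Adj h w)
    (huniv : insert h (C ∪ F) = Finset.univ) (v : V) : Covers G k v Finset.univ := by
  have hy : y ∈ C ∩ F := hCF ▸ Finset.mem_singleton_self y
  have hyC := (Finset.mem_inter.1 hy).1
  have hyF := (Finset.mem_inter.1 hy).2
  have hCF' : ∀ w ∈ C, w ∈ F → w = y := fun w hwC hwF =>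
    Finset.mem_singleton.1 (hCF ▸ Finset.mem_inter.2 ⟨hwC, hwF⟩)
  have hhC : h ∉ C := fun hh => G.irrefl (hadj h (Finset.mem_union_left _ hh))
  have hhF : h ∉ F := fun hh => G.irrefl (hadj h (Finset.mem_union_right _ hh))
  have hadjC : ∀ w ∈ C, G.Adj h w := fun w hw => hadj w (Finset.mem_union_left _ hw)
  have hadjF : ∀ w ∈ F, G.Adj h w := fun w hw => hadj w (Finset.mem_union_right _ hw)
  have hall : ∀ w, w = h ∨ w ∈ C ∨ w ∈ F := fun w => by
    have := Finset.mem_univ w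
    rwa [← huniv, Finset.mem_insert, Finset.mem_union] at this
  have hcF := hF.covers_insert_erase hadjF hyF
  have hdisj : Disjoint (insert h (F.erase y)) C := by
    rw [Finset.disjoint_left]
    intro w hw hwC
    simp only [Finset.mem_insert, Finset.mem_erase] at hw
    grind
  obtain ⟨k, rfl⟩ : ∃ m, k = m + 1 := ⟨k - 1, by lia⟩
  rw [Nat.add_sub_cancel] at hC
  by_cases hvh : v = h
  · subst hvh
    have := Covers.call (hadjC c hC.root_mem) hdisj (hcF.mono (by lia)) hC.covers
    convert this
    ext w
    simp only [Finset.mem_univ, Finset.mem_union, Finset.mem_insert, Finset.mem_erase]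
    grind
  by_cases hvF : v ∈ F
  · have := Covers.call (hadjF v hvF).symm (S := F) (S' := insert h (C.erase y)) (by
        rw [Finset.disjoint_left]
        intro w hw hwC
        simp only [Finset.mem_insert, Finset.mem_erase] at hwC
        grind)
      ((hF.covers_of_mem hvF).mono (by lia)) (hC.covers_insert_erase hadjC hyC)
    convert this
    ext w
    simp only [Finset.mem_univ, Finset.mem_union, Finset.mem_insert, Finset.mem_erase]
    grind
  · have hvC : v ∈ C := ((hall v).resolve_left hvh).resolve_right hvF
    obtain ⟨d, D, hvD, hDC, hD, hcov⟩ :=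
      hC.exists_sdiff_covers (i := (k + 1) / 2) (by lia) hadjC hvC
    have := Covers.call (hadjC v hvC).symm (S := D) (S' := insert h (F.erase y) ∪ C \ D)
      (Finset.disjoint_union_right.2 ⟨(hdisj.mono_right hDC).symm, Finset.disjoint_sdiff⟩)
      ((hD.covers_of_mem hvD).mono (by lia)) (hcov _ hdisj hcF)
    convert this
    ext w
    simp only [Finset.mem_univ, Finset.mem_union, Finset.mem_insert, Finset.mem_erase,
      Finset.mem_sdiff]
    grind

end Broadcast

/-- The graph on `{0, …, n - 1}` in which `0` is joined to all vertices of the tree on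
`{1, …, n - 1}` with parent function `par`. -/
def apexTree (par : ℕ → ℕ) (n : ℕ) : SimpleGraph (Fin n) :=
  SimpleGraph.fromRel fun a b => (a : ℕ) = 0 ∨ (a : ℕ) = par b

/-- The edges of `apexTree par (m + 2)`. -/
def apexTreeEdges (par : ℕ → ℕ) : ℕ → Multiset (Sym2 ℕ)
  | 0 => {s(0, 1)}
  | m + 1 => s(0, m + 2) ::ₘ s(m + 2, par (m + 2)) ::ₘ apexTreeEdges par m

theorem mem_apexTreeEdges {par : ℕ → ℕ} {m : ℕ} {e : Sym2 ℕ} :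
    e ∈ apexTreeEdges par m ↔
      ∃ x, 1 ≤ x ∧ x < m + 2 ∧ (e = s(0, x) ∨ 2 ≤ x ∧ e = s(x, par x)) := by
  induction m with
  | zero =>
    simp only [apexTreeEdges, Multiset.mem_singleton]
    constructor
    · rintro rfl
      exact ⟨1, by simp⟩
    · rintro ⟨x, h1, h2, h3⟩
      obtain rfl : x = 1 := by lia
      simpa using h3
  | succ m ih =>
    simp only [apexTreeEdges, Multiset.mem_cons, ih]
    constructor
    · rintro (rfl | rfl | ⟨x, h1, h2, h3⟩)
      · exact ⟨m + 2, by lia, by lia, .inl rfl⟩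
      · exact ⟨m + 2, by lia, by lia, .inr ⟨by lia, rfl⟩⟩
      · exact ⟨x, h1, by lia, h3⟩
    · rintro ⟨x, h1, h2, h3⟩
      by_cases hx : x = m + 2
      · subst hx
        rcases h3 with h3 | ⟨-, h3⟩ <;> simp [h3]
      · exact .inr (.inr ⟨x, h1, by lia, h3⟩)

theorem SPBuildFrom_apexTreeEdges {par : ℕ → ℕ} (hpar : ∀ x, 2 ≤ x → 1 ≤ par x ∧ par x < x)
    (m : ℕ) : SPBuildFrom {0, 1} {s(0, 1)} (Finset.range (m + 2)) (apexTreeEdges par m) := by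
  induction m with
  | zero => exact .base
  | succ m ih =>
    obtain ⟨h1, h2⟩ := hpar (m + 2) (by lia)
    have hmem : s(0, par (m + 2)) ∈ apexTreeEdges par m :=
      mem_apexTreeEdges.2 ⟨_, h1, h2, .inl rfl⟩
    have := SPBuildFrom.series 0 (par (m + 2)) (m + 2) (Multiset.mem_cons_self _ _) (by simp)
      (SPBuildFrom.parallel _ hmem ih)
    rwa [Multiset.erase_cons_head, ← Finset.range_add_one] at this

theorem isSP_apexTree {par : ℕ → ℕ} (hpar1 : par 1 = 1)
    (hpar : ∀ x, 2 ≤ x → 1 ≤ par x ∧ par x < x) {n : ℕ} (hn : 2 ≤ n) : IsSP (apexTree par n) := by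
  obtain ⟨m, rfl⟩ : ∃ m, n = m + 2 := ⟨n - 2, by lia⟩
  refine ⟨0, 1, Finset.range (m + 2), apexTreeEdges par m, by simp,
    SPBuildFrom_apexTreeEdges hpar m, ⟨⟨Fin.equivSubtype.trans
      (Equiv.subtypeEquivRight fun x => Finset.mem_range.symm), ?_⟩⟩⟩
  rintro ⟨a, ha⟩ ⟨b, hb⟩
  have key : ∀ a b, a < m + 2 → b < m + 2 → a ≠ b → (a = 0 ∨ a = par b) →
      s(a, b) ∈ apexTreeEdges par m := by
    intro a b ha hb hab h
    rw [mem_apexTreeEdges]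
    rcases h with rfl | rfl
    · exact ⟨b, by lia, hb, .inl rfl⟩
    · rcases Nat.lt_or_ge b 2 with h2 | h2
      · interval_cases b
        · exact ⟨par 0, by lia, ha, .inl Sym2.eq_swap⟩
        · exact absurd hpar1 hab
      · exact ⟨b, by lia, hb, .inr ⟨h2, Sym2.eq_swap⟩⟩
  have key' : ∀ a b, s(a, b) ∈ apexTreeEdges par m →
      (a = 0 ∨ a = par b) ∨ (b = 0 ∨ b = par a) := by
    intro a b h
    obtain ⟨x, -, -, h | ⟨-, h⟩⟩ := mem_apexTreeEdges.1 h <;>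
      rcases Sym2.eq_iff.1 h with ⟨rfl, rfl⟩ | ⟨rfl, rfl⟩ <;> simp
  simp only [underlyingGraph, apexTree, SimpleGraph.fromRel_adj, Equiv.trans_apply,
    Equiv.subtypeEquivRight_apply, Fin.equivSubtype_apply, ne_eq, Subtype.mk.injEq, Fin.mk.injEq]
  refine and_congr_right fun hab => ⟨?_, ?_⟩
  · rintro (h | h)
    · exact key' a b h
    · exact (key' b a h).symm
  · rintro (h | h)
    · exact .inl (key a b ha hb hab h)
    · exact .inr (key b a hb ha (Ne.symm hab) h)

/-- The number obtained from `x` by clearing its lowest binary digit `1`. -/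
def clearLowestBit (x : ℕ) : ℕ := x - 2 ^ padicValNat 2 x

theorem clearLowestBit_lt {x : ℕ} (hx : 0 < x) : clearLowestBit x < x :=
  Nat.sub_lt hx (by positivity)

theorem clearLowestBit_add {a b : ℕ} (h : 2 ^ (a + 1) ∣ b) : clearLowestBit (b + 2 ^ a) = b := by
  obtain ⟨c, rfl⟩ := h
  have hodd : padicValNat 2 (2 * c + 1) = 0 := padicValNat.eq_zero_of_not_dvd (by lia)
  have : 2 ^ (a + 1) * c + 2 ^ a = 2 ^ a * (2 * c + 1) := by ring
  have hval : padicValNat 2 (2 ^ (a + 1) * c + 2 ^ a) = a := by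
    rw [this, padicValNat.mul (by positivity) (by positivity), padicValNat.prime_pow, hodd,
      Nat.add_zero]
  rw [clearLowestBit, hval, Nat.add_sub_cancel]

/-- The parent function of the tree obtained by gluing two binomial trees at their root `1`; the
other vertices are `2, …, M` for the first tree and `M + 1, M + 2, …` for the second. -/
def gluedParent (M x : ℕ) : ℕ :=
  if x ≤ M then 1 + clearLowestBit (x - 1)
  else if clearLowestBit (x - M) = 0 then 1 else M + clearLowestBit (x - M)

theorem gluedParent_bounds {M x : ℕ} (hM : 1 ≤ M) (hx : 2 ≤ x) :
    1 ≤ gluedParent M x ∧ gluedParent M x < x := by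
  unfold gluedParent
  split_ifs with h1 h2
  · have := clearLowestBit_lt (x := x - 1) (by lia)
    lia
  · lia
  · have := clearLowestBit_lt (x := x - M) (by lia)
    lia

theorem apexTree_adj {par : ℕ → ℕ} {n : ℕ} {a b : Fin n} :
    (apexTree par n).Adj a b ↔
      a ≠ b ∧ (((a : ℕ) = 0 ∨ (a : ℕ) = par b) ∨ ((b : ℕ) = 0 ∨ (b : ℕ) = par a)) :=
  SimpleGraph.fromRel_adj _ _ _

theorem covers_apexTree_gluedParent {k M f : ℕ} (hk : 2 ≤ k) (hM : M = 2 ^ (k - 1))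
    (hf : f < 2 ^ (k / 2)) (v : Fin (M + f + 1)) :
    Covers (apexTree (gluedParent M) (M + f + 1)) k v Finset.univ := by
  have hMpos : 0 < M := by rw [hM]; positivity
  let e₁ : ℕ → Fin (M + f + 1) := fun j => Fin.ofNat _ (j + 1)
  let e₂ : ℕ → Fin (M + f + 1) := fun j => Fin.ofNat _ (if j = 0 then 1 else M + j)
  have he₁ : ∀ j < M, (e₁ j : ℕ) = j + 1 := fun j hj => Nat.mod_eq_of_lt (by lia)
  have he₂ : ∀ j < f + 1, (e₂ j : ℕ) = if j = 0 then 1 else M + j :=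
    fun j hj => Nat.mod_eq_of_lt (by split_ifs <;> lia)
  have hC := BinomialSubtree.of_labelling (G := apexTree (gluedParent M) (M + f + 1))
    (N := M) (e := e₁) (fun x hx y hy hxy => by
      have := congrArg Fin.val hxy
      rw [he₁ x hx, he₁ y hy] at this
      lia)
    (fun a b hab hlt => by
      have hpos : 0 < 2 ^ a := by positivity
      have h1 := he₁ b (by lia)
      have h2 := he₁ _ hlt
      refine apexTree_adj.2 ⟨fun h => ?_, .inl (.inr ?_)⟩
      · have := congrArg Fin.val h
        lia
      · rw [h1, h2, gluedParent, if_pos (by lia), Nat.add_sub_cancel, clearLowestBit_add hab]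
        lia)
    (k - 1) 0 (dvd_zero _) hMpos
  have hF := BinomialSubtree.of_labelling (G := apexTree (gluedParent M) (M + f + 1))
    (N := f + 1) (e := e₂) (fun x hx y hy hxy => by
      have := congrArg Fin.val hxy
      rw [he₂ x hx, he₂ y hy] at this
      split_ifs at this <;> lia)
    (fun a b hab hlt => by
      have hpos : 0 < 2 ^ a := by positivity
      have h1 := he₂ b (by lia)
      have h2 := he₂ _ hlt
      rw [if_neg (by lia)] at h2
      refine apexTree_adj.2 ⟨fun h => ?_, .inl (.inr ?_)⟩
      · have := congrArg Fin.val h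
        rw [h1, h2] at this
        split_ifs at this <;> lia
      · rw [h2, gluedParent, if_neg (by lia), Nat.add_sub_cancel_left,
          clearLowestBit_add hab, h1])
    (k / 2) 0 (dvd_zero _) (by lia)
  rw [Nat.zero_add, ← hM, min_self] at hC
  rw [Nat.zero_add, min_eq_right (by lia)] at hF
  have hmemC : ∀ w : Fin (M + f + 1),
      w ∈ (Finset.Ico 0 M).image e₁ ↔ 1 ≤ (w : ℕ) ∧ (w : ℕ) ≤ M := by
    intro w
    simp only [Finset.mem_image, Finset.mem_Ico]
    constructor
    · rintro ⟨j, hj, rfl⟩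
      rw [he₁ j hj.2]
      lia
    · intro hw
      exact ⟨w - 1, by lia, Fin.ext (by rw [he₁ _ (by lia)]; lia)⟩
  have hmemF : ∀ w : Fin (M + f + 1),
      w ∈ (Finset.Ico 0 (f + 1)).image e₂ ↔ (w : ℕ) = 1 ∨ M < (w : ℕ) := by
    intro w
    simp only [Finset.mem_image, Finset.mem_Ico]
    constructor
    · rintro ⟨j, hj, rfl⟩
      rw [he₂ j hj.2]
      split_ifs <;> lia
    · rintro (hw | hw)
      · exact ⟨0, by lia, Fin.ext (by rw [he₂ _ (by lia), if_pos rfl, hw])⟩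
      · exact ⟨w - M, by lia, Fin.ext (by rw [he₂ _ (by lia), if_neg (by lia)]; lia)⟩
  refine covers_univ_of_apex hk (h := 0) (y := e₁ 0) hC hF ?_ ?_ ?_ v
  · ext w
    rw [Finset.mem_inter, hmemC, hmemF, Finset.mem_singleton, Fin.ext_iff, he₁ 0 hMpos]
    lia
  · intro w hw
    rw [Finset.mem_union, hmemC, hmemF] at hw
    refine apexTree_adj.2 ⟨fun h => ?_, .inl (.inl rfl)⟩
    have := congrArg Fin.val h
    rw [Fin.val_zero] at this
    lia
  · ext w
    simp only [Finset.mem_insert, Finset.mem_union, hmemC, hmemF, Fin.ext_iff, Fin.val_zero,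
      Finset.mem_univ, iff_true]
    lia

/-- For every `k ≥ 2` and every `n` with
`2^(k-1) + 1 ≤ n ≤ 2^(k-1) + 2^⌊k/2⌋`, there exists a simple series-parallel broadcast
graph on `n` vertices: a simple SP graph `G` on `n` vertices with `b(G) = ⌈log₂ n⌉ = k`. -/
theorem exists_SP_broadcast_graph (k n : ℕ) (hk : 2 ≤ k)
    (h1 : 2 ^ (k - 1) + 1 ≤ n) (h2 : n ≤ 2 ^ (k - 1) + 2 ^ (k / 2)) :
    ∃ G : SimpleGraph (Fin n), IsSP G ∧
      broadcastTime G = k ∧ Nat.clog 2 n = k := by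
  have hle : 2 ^ (k / 2) ≤ 2 ^ (k - 1) := Nat.pow_le_pow_right (by norm_num) (by lia)
  have hpow : 2 ^ k = 2 ^ (k - 1) + 2 ^ (k - 1) := by
    rw [← Nat.two_mul, ← pow_succ', Nat.sub_add_cancel (by lia)]
  have hclog : Nat.clog 2 n = k := by
    apply le_antisymm
    · exact (Nat.clog_le_iff_le_pow (by norm_num)).2 (by lia)
    · have : k - 1 < Nat.clog 2 n := (Nat.lt_clog_iff_pow_lt (by norm_num)).2 (by lia)
      lia
  have hpos : 0 < 2 ^ (k - 1) := by positivity
  obtain ⟨f, rfl⟩ : ∃ f, n = 2 ^ (k - 1) + f + 1 := ⟨n - (2 ^ (k - 1) + 1), by lia⟩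
  refine ⟨apexTree (gluedParent (2 ^ (k - 1))) _, isSP_apexTree ?_
    (fun x hx => gluedParent_bounds hpos hx) (by lia), ?_, hclog⟩
  · rw [gluedParent, if_pos (by lia)]
    rfl
  · have hcard : Nat.clog 2 (Fintype.card (Fin (2 ^ (k - 1) + f + 1))) = k := by
      rw [Fintype.card_fin, hclog]
    rw [broadcastTime_eq_clog, hcard]
    intro v
    rw [hcard]
    exact covers_apexTree_gluedParent hk rfl (by lia) v
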